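/- The quotient of SL(2, F_5) by its center is isomorphic to the alternating group A_5. -/

import Mathlib

namespace SL25

/-- Class (one of five) of the traceless matrix `[[p,q],[r,-p]]` of determinant 1. Two such
matrices have the same class iff they agree up to sign or anticommute. -/
def cls (p q r : ZMod 5) : ZMod 5 := if r = 0 then 2 * q * p ^ 3 else p * r ^ 3

/-- Class of the conjugate of `[[p,q],[r,-p]]` by `[[a,b],[c,d]]`. -/
def act (a b c d p q r : ZMod 5) : ZMod 5 :=
  cls (a*d*p + b*d*r - a*c*q + b*c*p) (-2*a*b*p - b^2*r + a^2*q) (2*c*d*p + d^2*r - c^2*q)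

/-- Two traceless matrices agree up to sign or anticommute. -/
def rel (p q r s t u : ZMod 5) : Prop :=
  (s = p ∧ t = q ∧ u = r) ∨ (s = -p ∧ t = -q ∧ u = -r) ∨ 2*p*s + q*u + r*t = 0

instance (p q r s t u : ZMod 5) : Decidable (rel p q r s t u) := by
  unfold rel; infer_instance

lemma rel_cls : ∀ p q r : ZMod 5, p*p + q*r = 4 → rel p q r 2 (cls p q r) 0 := by
  decide +kernel

lemma cls_eq_of_rel : ∀ p q r : ZMod 5, p*p + q*r = 4 → ∀ s t u : ZMod 5, s*s + t*u = 4 →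
    rel p q r s t u → cls p q r = cls s t u := by
  decide +kernel

lemma norm_conj (a b c d p q r : ZMod 5) (hd : a*d = 1 + b*c) (h : p*p + q*r = 4) :
    (a*d*p + b*d*r - a*c*q + b*c*p) * (a*d*p + b*d*r - a*c*q + b*c*p) +
      (-2*a*b*p - b^2*r + a^2*q) * (2*c*d*p + d^2*r - c^2*q) = 4 := by
  linear_combination (a*d - b*c)^2 * h + 4 * (a*d - b*c + 1) * hd

lemma act_cls (p q r : ZMod 5) (h : p*p + q*r = 4) (a b c d : ZMod 5) (hd : a*d = 1 + b*c) :
    act a b c d p q r = act a b c d 2 (cls p q r) 0 := by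
  have h0 : (2 : ZMod 5) * 2 + cls p q r * 0 = 4 := by ring
  have hr := rel_cls p q r h
  refine cls_eq_of_rel _ _ _ (norm_conj a b c d p q r hd h) _ _ _
    (norm_conj a b c d _ _ _ hd h0) ?_
  generalize cls p q r = i at *
  rcases hr with ⟨h1, h2, h3⟩ | ⟨h1, h2, h3⟩ | h1
  · left
    rw [h1, h2, h3]
    exact ⟨rfl, rfl, rfl⟩
  · right; left
    rw [h1, h2, h3]
    refine ⟨?_, ?_, ?_⟩ <;> ring
  · right; right
    linear_combination (a*d - b*c)^2 * h1

set_option maxRecDepth 100000 in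
lemma act_one : ∀ a b c d : ZMod 5, a*d = 1 + b*c →
    ((∀ i, act a b c d 2 i 0 = i) ↔
      ((a = 1 ∧ b = 0 ∧ c = 0 ∧ d = 1) ∨ (a = -1 ∧ b = 0 ∧ c = 0 ∧ d = -1))) := by
  decide +kernel

lemma card4 : Fintype.card {v : (ZMod 5 × ZMod 5) × ZMod 5 × ZMod 5 //
    v.1.1*v.2.2 = 1 + v.1.2*v.2.1} = 120 := by decide +kernel

abbrev SL := Matrix.SpecialLinearGroup (Fin 2) (ZMod 5)

lemma det_eq (g : SL) : g 0 0 * g 1 1 = 1 + g 0 1 * g 1 0 := by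
  have h := g.det_coe
  rw [Matrix.det_fin_two] at h
  linear_combination h

lemma card_SL : Nat.card SL = 120 := by
  rw [← card4, ← Nat.card_eq_fintype_card]
  refine Nat.card_congr ⟨fun g => ⟨((g 0 0, g 0 1), g 1 0, g 1 1), det_eq g⟩,
    fun v => ⟨!![v.1.1.1, v.1.1.2; v.1.2.1, v.1.2.2], ?_⟩, ?_, ?_⟩
  · rw [Matrix.det_fin_two_of, v.2]; ring
  · intro g
    ext i j
    fin_cases i <;> fin_cases j <;> rfl
  · intro v
    rfl

/-- The action of a matrix on the five classes. -/
def fn (g : SL) (i : ZMod 5) : ZMod 5 := act (g 0 0) (g 0 1) (g 1 0) (g 1 1) 2 i 0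

lemma fn_mul (g h : SL) (i : ZMod 5) : fn (g * h) i = fn g (fn h i) := by
  have hh := det_eq h
  unfold fn
  conv_rhs => rw [act.eq_1 (h 0 0)]
  rw [← act_cls _ _ _ _ _ _ _ _ (det_eq g)]
  · simp only [act, Matrix.SpecialLinearGroup.coe_mul, Matrix.mul_apply, Fin.sum_univ_two]
    congr 1 <;> ring
  · linear_combination (4 * (h 0 0 * h 1 1 - h 0 1 * h 1 0 + 1)) * hh

lemma fn_one (i : ZMod 5) : fn 1 i = i := by
  revert i
  exact (act_one _ _ _ _ (det_eq 1)).2 (Or.inl (by simp))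

/-- The permutation representation on the five classes. -/
def hom : SL →* Equiv.Perm (Fin 5) where
  toFun g := (⟨fn g, fn g⁻¹, fun i => by rw [← fn_mul, inv_mul_cancel, fn_one],
    fun i => by rw [← fn_mul, mul_inv_cancel, fn_one]⟩ : Equiv.Perm (ZMod 5))
  map_one' := Equiv.ext fn_one
  map_mul' g h := Equiv.ext (fn_mul g h)

lemma mem_ker (g : SL) : g ∈ hom.ker ↔ g = 1 ∨ g = -1 := by
  have h1 : g ∈ hom.ker ↔ ∀ i, fn g i = i := by
    rw [MonoidHom.mem_ker, Equiv.ext_iff]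
    rfl
  rw [h1]
  refine (act_one _ _ _ _ (det_eq g)).trans ?_
  simp [Matrix.SpecialLinearGroup.ext_iff, Fin.forall_fin_two, and_assoc]

lemma ker_eq : hom.ker = Subgroup.center SL := by
  ext g
  rw [mem_ker, Matrix.SpecialLinearGroup.mem_center_iff]
  have h2 : ∀ r : ZMod 5, r ^ 2 = 1 ↔ r = 1 ∨ r = -1 := by decide
  simp only [Fintype.card_fin, h2]
  constructor
  · rintro (rfl | rfl)
    · exact ⟨1, by simp⟩
    · exact ⟨-1, Or.inr rfl, by rw [map_neg, map_one]; simp⟩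
  · rintro ⟨r, rfl | rfl, h⟩
    · left; apply Subtype.ext; rw [← h]; simp
    · right; apply Subtype.ext; rw [← h, map_neg, map_one]; simp

lemma card_ker : Nat.card hom.ker = 2 := by
  have h : ((hom.ker : Subgroup SL) : Set SL) = {1, -1} := by
    ext g
    simpa using mem_ker g
  have h1 : (1 : SL) ≠ -1 := by decide
  rw [← SetLike.coe_sort_coe, h, Nat.card_coe_set_eq, Set.ncard_pair h1]

lemma range_eq : hom.range = alternatingGroup (Fin 5) := by
  apply Equiv.Perm.eq_alternatingGroup_of_index_eq_two
  have h1 := hom.ker.card_mul_index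
  rw [card_ker, card_SL, Subgroup.index_ker] at h1
  have h2 := hom.range.card_mul_index
  have h3 : Nat.card (Equiv.Perm (Fin 5)) = 120 := by
    rw [Nat.card_eq_fintype_card, Fintype.card_perm, Fintype.card_fin]; rfl
  have h4 : Nat.card hom.range = 60 := by omega
  rw [h3, h4] at h2
  omega

end SL25

/-- The quotient of SL(2, F_5) by its center is isomorphic to the alternating group A_5. -/
theorem sl2_f5_mod_center_iso_alternating :
    Nonempty
      ((Matrix.SpecialLinearGroup (Fin 2) (ZMod 5) ⧸
          Subgroup.center (Matrix.SpecialLinearGroup (Fin 2) (ZMod 5))) ≃*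
        alternatingGroup (Fin 5)) :=  by
  exact ⟨(QuotientGroup.quotientMulEquivOfEq SL25.ker_eq.symm).trans
    ((QuotientGroup.quotientKerEquivRange SL25.hom).trans
      (MulEquiv.subgroupCongr SL25.range_eq))⟩
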